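/- Let K be a nonempty compact metrizable space and (L,d) a nonempty compact metric space. For a continuous map φ : K → L, let M(φ) : P(K) → P(L) denote the pushforward of measures, M(φ)(μ) = φ_*μ. Then for all continuous φ, ψ : K → L: sup_{μ ∈ P(K)} K_d(φ_*μ, ψ_*μ) = sup_{x ∈ K} d(φ(x), ψ(x)), where K_d is the Kantorovich metric on P(L). In other words, the map φ ↦ M(φ) from C(K,L) with the sup-metric induced by d to maps P(K) → P(L) with the sup-metric induced by K_d is isometric. -/

import Mathlib

open MeasureTheory Topology Set

/-- The Kantorovich metric on Borel probability measures induced by the metric of `L`: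
`K_d(μ,ν) = sup { |∫ f dμ − ∫ f dν| : f 1-Lipschitz }`. -/
noncomputable def kantorovichDist {L : Type*} [MetricSpace L] [MeasurableSpace L]
    (μ ν : ProbabilityMeasure L) : ℝ :=
  sSup {r : ℝ | ∃ f : L → ℝ, LipschitzWith 1 f ∧
    r = |(∫ x, f x ∂(μ : Measure L)) - (∫ x, f x ∂(ν : Measure L))|}

/-- The pushforward of a Borel probability measure by a measurable map. -/
noncomputable def pushPM {K L : Type*} [MeasurableSpace K] [MeasurableSpace L]
    {φ : K → L} (hφ : Measurable φ) (μ : ProbabilityMeasure K) : ProbabilityMeasure L :=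
  μ.map hφ.aemeasurable

theorem integral_pushPM {K L : Type*} [MeasurableSpace K] [TopologicalSpace L]
    [TopologicalSpace.PseudoMetrizableSpace L] [SecondCountableTopology L]
    [MeasurableSpace L] [BorelSpace L] {φ : K → L} (hφ : Measurable φ)
    (μ : ProbabilityMeasure K) {f : L → ℝ} (hf : Continuous f) :
    ∫ y, f y ∂(pushPM hφ μ : Measure L) = ∫ x, f (φ x) ∂(μ : Measure K) :=
  integral_map hφ.aemeasurable hf.aestronglyMeasurable

/-- Two pushforwards of one measure differ on a `1`-Lipschitz function by at most any uniform
bound on the distance of the maps. -/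
theorem abs_integral_pushPM_sub_le {K L : Type*} [TopologicalSpace K] [CompactSpace K]
    [MeasurableSpace K] [BorelSpace K]
    [MetricSpace L] [CompactSpace L] [MeasurableSpace L] [BorelSpace L]
    {φ ψ : K → L} (hφ : Continuous φ) (hψ : Continuous ψ) {C : ℝ}
    (hC : ∀ x, dist (φ x) (ψ x) ≤ C) (μ : ProbabilityMeasure K)
    {f : L → ℝ} (hf : LipschitzWith 1 f) :
    |(∫ y, f y ∂(pushPM hφ.measurable μ : Measure L)) -
      (∫ y, f y ∂(pushPM hψ.measurable μ : Measure L))| ≤ C := by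
  have integrable_comp {χ : K → L} (hχ : Continuous χ) :
      Integrable (fun x => f (χ x)) (μ : Measure K) :=
    (hf.continuous.comp hχ).integrable_of_hasCompactSupport (HasCompactSupport.of_compactSpace _)
  rw [integral_pushPM _ _ hf.continuous, integral_pushPM _ _ hf.continuous,
    ← integral_sub (integrable_comp hφ) (integrable_comp hψ), ← Real.norm_eq_abs]
  refine (norm_integral_le_of_norm_le_const (C := C) (.of_forall fun x => ?_)).trans (by simp)
  rw [← dist_eq_norm]
  exact (hf.dist_le_mul (φ x) (ψ x)).trans (by simpa using hC x)

theorem kantorovichDist_pushPM_le {K L : Type*} [TopologicalSpace K] [CompactSpace K]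
    [MeasurableSpace K] [BorelSpace K]
    [MetricSpace L] [CompactSpace L] [MeasurableSpace L] [BorelSpace L]
    {φ ψ : K → L} (hφ : Continuous φ) (hψ : Continuous ψ) {C : ℝ}
    (hC : ∀ x, dist (φ x) (ψ x) ≤ C) (μ : ProbabilityMeasure K) :
    kantorovichDist (pushPM hφ.measurable μ) (pushPM hψ.measurable μ) ≤ C := by
  refine csSup_le ⟨_, fun _ => 0, LipschitzWith.const' 0, rfl⟩ ?_
  rintro r ⟨f, hf, rfl⟩
  exact abs_integral_pushPM_sub_le hφ hψ hC μ hf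

/-- The Kantorovich distance of the images of a Dirac mass dominates the distance of the image
points. -/
theorem dist_le_kantorovichDist_pushPM_diracProba {K L : Type*} [TopologicalSpace K]
    [CompactSpace K] [TopologicalSpace.MetrizableSpace K] [MeasurableSpace K] [BorelSpace K]
    [MetricSpace L] [CompactSpace L] [MeasurableSpace L] [BorelSpace L]
    {φ ψ : K → L} (hφ : Continuous φ) (hψ : Continuous ψ) {C : ℝ}
    (hC : ∀ x, dist (φ x) (ψ x) ≤ C) (x : K) :
    dist (φ x) (ψ x) ≤ kantorovichDist (pushPM hφ.measurable (diracProba x))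
      (pushPM hψ.measurable (diracProba x)) := by
  refine le_csSup ⟨C, ?_⟩ ⟨fun y => dist y (ψ x), LipschitzWith.dist_left _, ?_⟩
  · rintro r ⟨f, hf, rfl⟩
    exact abs_integral_pushPM_sub_le hφ hψ hC _ hf
  · have hf : Continuous fun y => dist y (ψ x) := by fun_prop
    rw [integral_pushPM _ _ hf, integral_pushPM _ _ hf]
    simp [diracProba]

/-- **The pushforward functor is isometric for the sup-metrics.**
For `K` a nonempty compact metrizable space, `(L,d)` a nonempty compact metric space, and
continuous `φ, ψ : K → L`: `sup_{μ ∈ P(K)} K_d(φ_*μ, ψ_*μ) = sup_{x ∈ K} d(φ(x), ψ(x))`. -/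
theorem pushforward_isometric_supDist
    {K L : Type*} [TopologicalSpace K] [CompactSpace K]
    [TopologicalSpace.MetrizableSpace K] [Nonempty K]
    [MeasurableSpace K] [BorelSpace K]
    [MetricSpace L] [CompactSpace L] [Nonempty L] [MeasurableSpace L] [BorelSpace L]
    (φ ψ : K → L) (hφ : Continuous φ) (hψ : Continuous ψ) :
    (⨆ μ : ProbabilityMeasure K,
        kantorovichDist (pushPM hφ.measurable μ) (pushPM hψ.measurable μ))
      = ⨆ x : K, dist (φ x) (ψ x) := by
  have hbdd : BddAbove (range fun x => dist (φ x) (ψ x)) :=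
    (isCompact_range (hφ.dist hψ)).bddAbove
  have hC : ∀ x, dist (φ x) (ψ x) ≤ ⨆ x, dist (φ x) (ψ x) := le_ciSup hbdd
  have : Nonempty (ProbabilityMeasure K) := ‹Nonempty K›.map diracProba
  refine le_antisymm (ciSup_le (kantorovichDist_pushPM_le hφ hψ hC)) (ciSup_le fun x => ?_)
  refine (dist_le_kantorovichDist_pushPM_diracProba hφ hψ hC x).trans (le_ciSup
    (f := fun μ => kantorovichDist (pushPM hφ.measurable μ) (pushPM hψ.measurable μ))
    ⟨⨆ x, dist (φ x) (ψ x), ?_⟩ (diracProba x))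
  rintro _ ⟨μ, rfl⟩
  exact kantorovichDist_pushPM_le hφ hψ hC μ
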